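/- Let π be a μ-projective unitary representation of a countable discrete group G on a complex separable Hilbert space H and suppose {π(g)ξ}_{g∈G} is a Parseval frame for H. Then a vector η ∈ H is a Bessel vector for π if and only if there is an operator U ∈ π(G)'' with η = Uξ; that is, B_π = π(G)''ξ. -/

import Mathlib

open scoped InnerProductSpace

noncomputable section

variable {G : Type*} {H : Type*} [NormedAddCommGroup H] [InnerProductSpace ℂ H]

/-- `π` is a projective unitary representation of `G` on `H` with multiplier `mu`:
each `π g` is a unitary operator (a surjective linear isometry) and
`π g ∘ π h = mu g h • π (g * h)`, where `|mu g h| = 1`. -/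
def IsProjUnitaryRep [Group G] (mu : G → G → ℂ) (π : G → H →L[ℂ] H) : Prop :=
  (∀ g h, ‖mu g h‖ = 1) ∧
  (∀ g, (∀ x : H, ‖π g x‖ = ‖x‖) ∧ Function.Surjective (π g)) ∧
  (∀ g h, (π g).comp (π h) = mu g h • π (g * h))

/-- `π` is a unitary representation of `G` on `H`. -/
def IsUnitaryRep [Group G] (π : G → H →L[ℂ] H) : Prop :=
  (∀ g, (∀ x : H, ‖π g x‖ = ‖x‖) ∧ Function.Surjective (π g)) ∧
  (∀ g h, (π g).comp (π h) = π (g * h))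

/-- `ξ` is a Bessel vector for `π`: `∑_g |⟨x, π g ξ⟩|² ≤ B‖x‖²` for all `x ∈ H`
(expressed via finite partial sums). -/
def IsBesselVector (π : G → H →L[ℂ] H) (ξ : H) : Prop :=
  ∃ B : ℝ, 0 < B ∧ ∀ x : H, ∀ s : Finset G, ∑ g ∈ s, ‖⟪x, π g ξ⟫_ℂ‖ ^ 2 ≤ B * ‖x‖ ^ 2

/-- `{π g ξ}_{g ∈ G}` satisfies the frame inequalities
`A‖x‖² ≤ ∑_g |⟨x, π g ξ⟩|² ≤ B‖x‖²` for all `x` in the set `M`. -/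
def IsFrameOn (π : G → H →L[ℂ] H) (ξ : H) (M : Set H) : Prop :=
  ∃ A B : ℝ, 0 < A ∧ A ≤ B ∧ ∀ x ∈ M,
    Summable (fun g : G => ‖⟪x, π g ξ⟫_ℂ‖ ^ 2) ∧
    A * ‖x‖ ^ 2 ≤ ∑' g : G, ‖⟪x, π g ξ⟫_ℂ‖ ^ 2 ∧
    ∑' g : G, ‖⟪x, π g ξ⟫_ℂ‖ ^ 2 ≤ B * ‖x‖ ^ 2

/-- The closed linear span of the orbit `{π g ξ : g ∈ G}`. -/
def orbitSpan (π : G → H →L[ℂ] H) (ξ : H) : Set H :=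
  closure (Submodule.span ℂ (Set.range fun g : G => π g ξ) : Set H)

/-- `{π g ξ}_{g ∈ G}` is a frame sequence: a frame for its closed linear span. -/
def IsFrameSequence (π : G → H →L[ℂ] H) (ξ : H) : Prop :=
  IsFrameOn π ξ (orbitSpan π ξ)

/-- `ξ` is a complete frame vector for `π`: `{π g ξ}_{g ∈ G}` is a frame for `H`. -/
def IsCompleteFrameVector (π : G → H →L[ℂ] H) (ξ : H) : Prop :=
  IsFrameOn π ξ Set.univ

/-- `{π g ξ}_{g ∈ G}` is a Parseval frame on the set `M`:
`∑_g |⟨x, π g ξ⟩|² = ‖x‖²` for all `x ∈ M`. -/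
def IsParsevalFrameOn (π : G → H →L[ℂ] H) (ξ : H) (M : Set H) : Prop :=
  ∀ x ∈ M, HasSum (fun g : G => ‖⟪x, π g ξ⟫_ℂ‖ ^ 2) (‖x‖ ^ 2)

/-- `{π g η}_{g ∈ G}` is a Riesz sequence:
`A ∑ |c g|² ≤ ‖∑ c g • π g η‖² ≤ B ∑ |c g|²` for all finitely supported `c`. -/
def IsRieszSequence (π : G → H →L[ℂ] H) (η : H) : Prop :=
  ∃ A B : ℝ, 0 < A ∧ A ≤ B ∧ ∀ c : G →₀ ℂ,
    A * ∑ g ∈ c.support, ‖c g‖ ^ 2 ≤ ‖∑ g ∈ c.support, c g • π g η‖ ^ 2 ∧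
    ‖∑ g ∈ c.support, c g • π g η‖ ^ 2 ≤ B * ∑ g ∈ c.support, ‖c g‖ ^ 2

/-- The commutant `S' = {T : T A = A T for all A ∈ S}` of a set `S` of operators. -/
def commutant (S : Set (H →L[ℂ] H)) : Set (H →L[ℂ] H) := Set.centralizer S

/-- `(π, σ)` is a commuting pair: `π(G)' = σ(G)''`. -/
def IsCommutingPair (π σ : G → H →L[ℂ] H) : Prop :=
  commutant (Set.range π) = commutant (commutant (Set.range σ))

end

section StarSubalgebra

variable {H : Type*} [NormedAddCommGroup H] [InnerProductSpace ℂ H] [CompleteSpace H]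

/-- If `‖T η‖ ≤ C * ‖T ξ‖` for all `T` in a star subalgebra `A`, then `T ξ ↦ T η` extends to an
operator in the commutant of `A`. -/
theorem StarSubalgebra.exists_mem_centralizer_apply_eq (A : StarSubalgebra ℂ (H →L[ℂ] H))
    {ξ η : H} {C : ℝ} (hC : ∀ T ∈ A, ‖T η‖ ≤ C * ‖T ξ‖) :
    ∃ U ∈ Set.centralizer (A : Set (H →L[ℂ] H)), U ξ = η := by
  let ev (v : H) : A →ₗ[ℂ] H :=
    { toFun := fun T => (T : H →L[ℂ] H) v
      map_add' := fun _ _ => rfl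
      map_smul' := fun _ _ => rfl }
  let M : Submodule ℂ H := (LinearMap.range (ev ξ)).topologicalClosure
  have hMc : IsClosed (M : Set H) := Submodule.isClosed_topologicalClosure _
  have : CompleteSpace M := hMc.completeSpace_coe
  have hmem (T : A) : ev ξ T ∈ M :=
    Submodule.le_topologicalClosure _ (LinearMap.mem_range_self _ T)
  let e : A →ₗ[ℂ] M := (ev ξ).codRestrict M hmem
  have he : DenseRange e := by
    intro m
    rw [closure_subtype, ← Set.range_comp]
    exact m.2
  have hnorm : ∃ C, ∀ T, ‖ev η T‖ ≤ C * ‖e T‖ := ⟨C, fun T => hC T T.2⟩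
  let V : M →L[ℂ] H := (ev η).extendOfNorm e
  have hV (T : A) : V (e T) = (T : H →L[ℂ] H) η := LinearMap.extendOfNorm_eq he hnorm T
  have hstable (T : A) (m : M) : (T : H →L[ℂ] H) m ∈ M := by
    refine he.induction_on (p := fun m : M => (T : H →L[ℂ] H) m ∈ M) m
      (hMc.preimage (by fun_prop)) fun S => hmem (T * S)
  have hcomm (T : A) (m : M) : V ⟨(T : H →L[ℂ] H) m, hstable T m⟩ = (T : H →L[ℂ] H) (V m) := by
    refine he.induction_on
      (p := fun m : M => V ⟨(T : H →L[ℂ] H) m, hstable T m⟩ = (T : H →L[ℂ] H) (V m)) m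
      (isClosed_eq (by fun_prop) (by fun_prop)) fun S => ?_
    rw [hV]
    exact hV (T * S)
  have hproj (T : A) (x : H) : M.orthogonalProjectionOnto ((T : H →L[ℂ] H) x) =
      ⟨(T : H →L[ℂ] H) (M.orthogonalProjectionOnto x), hstable T _⟩ := by
    refine Subtype.ext ?_
    refine Submodule.eq_starProjection_of_mem_of_inner_eq_zero (hstable T _) fun w hw => ?_
    rw [← map_sub, ← ContinuousLinearMap.adjoint_inner_right]
    exact Submodule.starProjection_inner_eq_zero x _ (hstable (star T) ⟨w, hw⟩)
  refine ⟨V.comp M.orthogonalProjectionOnto, fun T hT => ?_, ?_⟩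
  · ext x
    simp only [mul_apply_eq_comp, ContinuousLinearMap.comp_apply]
    rw [hproj ⟨T, hT⟩, hcomm ⟨T, hT⟩]
  · have h1 : M.orthogonalProjectionOnto ξ = e 1 :=
      Submodule.orthogonalProjectionOnto_mem_subspace_eq_self (e 1)
    rw [ContinuousLinearMap.comp_apply, h1, hV]
    rfl

/-- If `U` commutes with the positive operator `Θ† Θ`, then
`‖Θ (U v)‖ ≤ ‖U‖ * ‖Θ v‖`. -/
theorem ContinuousLinearMap.norm_apply_apply_le_of_commute {K : Type*} [NormedAddCommGroup K]
    [InnerProductSpace ℂ K] [CompleteSpace K] (Θ : H →L[ℂ] K) {U : H →L[ℂ] H}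
    (hU : Commute (Θ.adjoint.comp Θ) U) (v : H) : ‖Θ (U v)‖ ≤ ‖U‖ * ‖Θ v‖ := by
  set P : H →L[ℂ] H := Θ.adjoint.comp Θ with hP
  have hP0 : 0 ≤ P :=
    (ContinuousLinearMap.nonneg_iff_isPositive P).2
      (ContinuousLinearMap.isPositive_adjoint_comp_self Θ)
  set R : H →L[ℂ] H := CFC.sqrt P
  have hRR : R * R = P := CFC.sqrt_mul_sqrt_self P
  have hRsa : star R = R := (IsSelfAdjoint.of_nonneg (CFC.sqrt_nonneg P)).star_eq
  have hRU : Commute R U := hU.cfcₙ_nnreal _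
  have hnorm (x : H) : ‖Θ x‖ = ‖R x‖ := by
    have h1 := ContinuousLinearMap.apply_norm_sq_eq_inner_adjoint_left Θ x
    have h2 := ContinuousLinearMap.apply_norm_sq_eq_inner_adjoint_left R x
    have h3 : R.adjoint.comp R = P := by
      rw [← hRR, ← ContinuousLinearMap.star_eq_adjoint, hRsa]
      rfl
    rw [h3] at h2
    exact (sq_eq_sq₀ (norm_nonneg _) (norm_nonneg _)).1 (h1.trans h2.symm)
  rw [hnorm, hnorm, show R (U v) = U (R v) from DFunLike.congr_fun hRU.eq v]
  exact U.le_opNorm _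

end StarSubalgebra

theorem mem_commutant_range_iff {G : Type*} {H : Type*} [NormedAddCommGroup H]
    [InnerProductSpace ℂ H] {π : G → H →L[ℂ] H} {T : H →L[ℂ] H} :
    T ∈ commutant (Set.range π) ↔ ∀ g x, π g (T x) = T (π g x) := by
  refine Set.forall_mem_range.trans (forall_congr' fun g => ?_)
  rw [ContinuousLinearMap.ext_iff]
  rfl

namespace IsProjUnitaryRep

variable {G : Type*} [Group G] {H : Type*} [NormedAddCommGroup H] [InnerProductSpace ℂ H]
  {mu : G → G → ℂ} {π : G → H →L[ℂ] H}

theorem apply_apply (hπ : IsProjUnitaryRep mu π) (g h : G) (x : H) :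
    π g (π h x) = mu g h • π (g * h) x :=
  DFunLike.congr_fun (hπ.2.2 g h) x

theorem inner_map_map (hπ : IsProjUnitaryRep mu π) (g : G) (x y : H) :
    ⟪π g x, π g y⟫_ℂ = ⟪x, y⟫_ℂ :=
  LinearIsometry.inner_map_map ⟨(π g).toLinearMap, (hπ.2.1 g).1⟩ x y

theorem map_one_apply (hπ : IsProjUnitaryRep mu π) (x : H) : π 1 x = mu 1 1 • x := by
  obtain ⟨y, rfl⟩ := (hπ.2.1 1).2 x
  rw [hπ.apply_apply, one_mul]

theorem norm_inner_inv_left (hπ : IsProjUnitaryRep mu π) (g : G) (x y : H) :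
    ‖⟪π g⁻¹ x, y⟫_ℂ‖ = ‖⟪x, π g y⟫_ℂ‖ := by
  rw [← hπ.inner_map_map g, hπ.apply_apply, mul_inv_cancel, hπ.map_one_apply, inner_smul_left,
    inner_smul_left, norm_mul, norm_mul, RCLike.norm_conj, RCLike.norm_conj, hπ.1, hπ.1, one_mul,
    one_mul]

theorem mem_commutant_of_inner (hπ : IsProjUnitaryRep mu π) {T : H →L[ℂ] H}
    (hT : ∀ g x y, ⟪T (π g x), π g y⟫_ℂ = ⟪T x, y⟫_ℂ) : T ∈ commutant (Set.range π) := by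
  refine mem_commutant_range_iff.2 fun g x => ext_inner_right ℂ fun w => ?_
  obtain ⟨y, rfl⟩ := (hπ.2.1 g).2 w
  rw [hπ.inner_map_map, hT]

theorem star_mem_commutant [CompleteSpace H] (hπ : IsProjUnitaryRep mu π) {T : H →L[ℂ] H}
    (hT : T ∈ commutant (Set.range π)) : star T ∈ commutant (Set.range π) := by
  refine hπ.mem_commutant_of_inner fun g x y => ?_
  rw [ContinuousLinearMap.star_eq_adjoint, ContinuousLinearMap.adjoint_inner_left,
    ContinuousLinearMap.adjoint_inner_left, ← mem_commutant_range_iff.1 hT, hπ.inner_map_map]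

/-- The commutant of a projective unitary representation, as a star subalgebra. -/
def commutantStarSubalgebra [CompleteSpace H] (hπ : IsProjUnitaryRep mu π) :
    StarSubalgebra ℂ (H →L[ℂ] H) :=
  { Subalgebra.centralizer ℂ (Set.range π) with
    star_mem' := fun hT => hπ.star_mem_commutant hT }

end IsProjUnitaryRep

namespace IsBesselVector

variable {G : Type*} {H : Type*} [NormedAddCommGroup H] [InnerProductSpace ℂ H]
  {π : G → H →L[ℂ] H}

/-- The analysis operator `x ↦ (⟪π g η, x⟫)_g` of a Bessel vector `η`. -/
theorem exists_analysis {η : H} (hη : IsBesselVector π η) :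
    ∃ Θ : H →L[ℂ] lp (fun _ : G => ℂ) 2, ∀ x g, Θ x g = ⟪π g η, x⟫_ℂ := by
  obtain ⟨B, hB, hη⟩ := hη
  have hη' (x : H) (s : Finset G) :
      ∑ g ∈ s, ‖⟪π g η, x⟫_ℂ‖ ^ (2 : ENNReal).toReal ≤ B * ‖x‖ ^ 2 := by
    simpa [norm_inner_symm] using hη x s
  let Θ : H →ₗ[ℂ] lp (fun _ : G => ℂ) 2 :=
    { toFun := fun x => ⟨fun g => ⟪π g η, x⟫_ℂ, memℓp_gen' (hη' x)⟩
      map_add' := fun x y => by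
        ext g
        exact inner_add_right _ _ _
      map_smul' := fun c x => by
        ext g
        exact inner_smul_right _ _ _ }
  refine ⟨Θ.mkContinuous √B fun x => ?_, fun _ _ => rfl⟩
  refine lp.norm_le_of_forall_sum_le (by simp) (by positivity) fun s => ?_
  refine (hη' x s).trans_eq ?_
  simp [mul_pow, Real.sq_sqrt hB.le]

theorem add {η ζ : H} (hη : IsBesselVector π η) (hζ : IsBesselVector π ζ) :
    IsBesselVector π (η + ζ) := by
  obtain ⟨B, hB, hη⟩ := hη
  obtain ⟨C, hC, hζ⟩ := hζ
  refine ⟨2 * (B + C), by positivity, fun x s => ?_⟩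
  calc ∑ g ∈ s, ‖⟪x, π g (η + ζ)⟫_ℂ‖ ^ 2
      ≤ ∑ g ∈ s, 2 * (‖⟪x, π g η⟫_ℂ‖ ^ 2 + ‖⟪x, π g ζ⟫_ℂ‖ ^ 2) := by
        gcongr with g
        rw [map_add, inner_add_right]
        exact (pow_le_pow_left₀ (norm_nonneg _) (norm_add_le _ _) 2).trans add_sq_le
    _ ≤ 2 * (B + C) * ‖x‖ ^ 2 := by
        rw [← Finset.mul_sum, Finset.sum_add_distrib]
        linarith [hη x s, hζ x s]

theorem smul {η : H} (c : ℂ) (hη : IsBesselVector π η) : IsBesselVector π (c • η) := by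
  obtain ⟨B, hB, hη⟩ := hη
  refine ⟨(‖c‖ ^ 2 + 1) * B, by positivity, fun x s => ?_⟩
  simp only [map_smul, inner_smul_right, norm_mul, mul_pow, ← Finset.mul_sum]
  rw [mul_assoc]
  exact mul_le_mul (by linarith) (hη x s) (by positivity) (by positivity)

theorem zero : IsBesselVector π (0 : H) :=
  ⟨1, one_pos, fun x s => by simp⟩

theorem orbit [Group G] {mu : G → G → ℂ} (hπ : IsProjUnitaryRep mu π) {η : H}
    (hη : IsBesselVector π η) (h : G) : IsBesselVector π (π h η) := by
  obtain ⟨B, hB, hη⟩ := hη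
  refine ⟨B, hB, fun x s => ?_⟩
  convert! hη x (s.map (mulRightEmbedding h)) using 1
  simp [hπ.apply_apply, hπ.1]

end IsBesselVector

namespace IsParsevalFrameOn

variable {G : Type*} {H : Type*} [NormedAddCommGroup H] [InnerProductSpace ℂ H]
  {π : G → H →L[ℂ] H} {ξ : H}

theorem isBesselVector (hξ : IsParsevalFrameOn π ξ Set.univ) : IsBesselVector π ξ :=
  ⟨1, one_pos, fun x s => by
    rw [one_mul]
    exact sum_le_hasSum s (fun _ _ => by positivity) (hξ x trivial)⟩

theorem dense_span [CompleteSpace H] (hξ : IsParsevalFrameOn π ξ Set.univ) :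
    Dense (Submodule.span ℂ (Set.range fun g => π g ξ) : Set H) := by
  rw [Submodule.dense_iff_topologicalClosure_eq_top, Submodule.topologicalClosure_eq_top_iff,
    Submodule.eq_bot_iff]
  intro x hx
  have h0 (g : G) : ⟪x, π g ξ⟫_ℂ = 0 :=
    (Submodule.mem_orthogonal' _ x).1 hx _ (Submodule.subset_span ⟨g, rfl⟩)
  have h := hξ x trivial
  simp only [h0, norm_zero, ne_eq, OfNat.ofNat_ne_zero, not_false_eq_true, zero_pow] at h
  simpa using h.unique hasSum_zero

variable [Group G] {mu : G → G → ℂ} [CompleteSpace H]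

theorem dense_isBesselVector (hπ : IsProjUnitaryRep mu π)
    (hξ : IsParsevalFrameOn π ξ Set.univ) : Dense {y : H | IsBesselVector π y} := by
  refine hξ.dense_span.mono fun y hy => ?_
  induction hy using Submodule.span_induction with
  | mem y hy =>
    obtain ⟨h, rfl⟩ := hy
    exact hξ.isBesselVector.orbit hπ h
  | zero => exact .zero
  | add _ _ _ _ hx hy => exact hx.add hy
  | smul c _ _ hx => exact hx.smul c

/-- A Bessel bound for `η`, transported along the commutant of `π`. -/
theorem norm_sq_apply_le (hπ : IsProjUnitaryRep mu π) (hξ : IsParsevalFrameOn π ξ Set.univ)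
    {η : H} {B : ℝ}
    (hη : ∀ x : H, ∀ s : Finset G, ∑ g ∈ s, ‖⟪x, π g η⟫_ℂ‖ ^ 2 ≤ B * ‖x‖ ^ 2)
    {T : H →L[ℂ] H} (hT : T ∈ commutant (Set.range π)) :
    ‖T η‖ ^ 2 ≤ B * ‖star T ξ‖ ^ 2 := by
  refine hasSum_le_of_sum_le (hξ (T η) trivial) fun s => ?_
  convert! hη (star T ξ) (s.map (Equiv.inv G).toEmbedding) using 1
  simp only [Finset.sum_map, Equiv.coe_toEmbedding, Equiv.inv_apply]
  refine Finset.sum_congr rfl fun g _ => ?_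
  rw [← hπ.norm_inner_inv_left, mem_commutant_range_iff.1 hT, norm_inner_symm,
    ContinuousLinearMap.star_eq_adjoint, ContinuousLinearMap.adjoint_inner_left]

theorem norm_star_apply_le (hπ : IsProjUnitaryRep mu π) (hξ : IsParsevalFrameOn π ξ Set.univ)
    {T : H →L[ℂ] H} (hT : T ∈ commutant (Set.range π)) : ‖star T ξ‖ ≤ ‖T ξ‖ := by
  have h := norm_sq_apply_le hπ hξ (η := ξ) (B := 1)
    (fun x s => by
      rw [one_mul]
      exact sum_le_hasSum s (fun _ _ => by positivity) (hξ x trivial))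
    (hπ.star_mem_commutant hT)
  rw [star_star, one_mul] at h
  exact (sq_le_sq₀ (norm_nonneg _) (norm_nonneg _)).1 h

theorem exists_mem_bicommutant (hπ : IsProjUnitaryRep mu π)
    (hξ : IsParsevalFrameOn π ξ Set.univ) {η : H} (hη : IsBesselVector π η) :
    ∃ U ∈ commutant (commutant (Set.range π)), η = U ξ := by
  obtain ⟨B, hB, hη⟩ := hη
  obtain ⟨U, hU, h⟩ := hπ.commutantStarSubalgebra.exists_mem_centralizer_apply_eq
    (ξ := ξ) (η := η) (C := √B) fun T hT => by
      have h1 := norm_sq_apply_le hπ hξ hη hT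
      have h2 := norm_star_apply_le hπ hξ hT
      refine le_of_sq_le_sq ?_ (by positivity)
      rw [mul_pow, Real.sq_sqrt hB.le]
      exact h1.trans (by gcongr)
  exact ⟨U, hU, h.symm⟩

theorem sum_norm_sq_le_of_isBesselVector (hπ : IsProjUnitaryRep mu π)
    (hξ : IsParsevalFrameOn π ξ Set.univ) {U : H →L[ℂ] H}
    (hU : U ∈ commutant (commutant (Set.range π))) {y : H} (hy : IsBesselVector π y)
    (s : Finset G) : ∑ g ∈ s, ‖⟪y, π g (U ξ)⟫_ℂ‖ ^ 2 ≤ ‖U‖ ^ 2 * ‖y‖ ^ 2 := by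
  obtain ⟨Θ, hΘ⟩ := hy.exists_analysis
  have hsum (v : H) : HasSum (fun g => ‖⟪y, π g v⟫_ℂ‖ ^ 2) (‖Θ v‖ ^ 2) := by
    have h := lp.hasSum_norm (p := 2) (by simp) (Θ v)
    simp only [ENNReal.toReal_ofNat, Real.rpow_ofNat, hΘ] at h
    refine ((Equiv.inv G).hasSum_iff.2 h).congr_fun fun g => ?_
    simp [hπ.norm_inner_inv_left]
  have hcomm : Θ.adjoint.comp Θ ∈ commutant (Set.range π) := by
    refine hπ.mem_commutant_of_inner fun h v w => ?_
    rw [ContinuousLinearMap.comp_apply, ContinuousLinearMap.adjoint_inner_left,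
      ContinuousLinearMap.comp_apply, ContinuousLinearMap.adjoint_inner_left]
    have hphase (g : G) (u : H) :
        Θ u g = (starRingEnd ℂ) (mu h g) • Θ (π h u) (h * g) := by
      rw [hΘ, hΘ, smul_eq_mul, ← inner_smul_left, ← hπ.apply_apply, hπ.inner_map_map]
    have hterm (g : G) :
        ⟪Θ (π h v) (h * g), Θ (π h w) (h * g)⟫_ℂ = ⟪Θ v g, Θ w g⟫_ℂ := by
      rw [hphase g v, hphase g w, inner_smul_left,
        inner_smul_right, ← mul_assoc, Complex.conj_mul', RCLike.norm_conj, hπ.1]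
      simp
    have h1 := (Equiv.mulLeft h).hasSum_iff.2
      (lp.hasSum_inner (𝕜 := ℂ) (Θ (π h v)) (Θ (π h w)))
    refine h1.unique ?_
    simp only [Function.comp_def, Equiv.coe_mulLeft, hterm]
    exact lp.hasSum_inner (Θ v) (Θ w)
  have hξy : ‖Θ ξ‖ ^ 2 = ‖y‖ ^ 2 := (hsum ξ).unique (hξ y trivial)
  calc ∑ g ∈ s, ‖⟪y, π g (U ξ)⟫_ℂ‖ ^ 2
      ≤ ‖Θ (U ξ)‖ ^ 2 := sum_le_hasSum s (fun _ _ => by positivity) (hsum (U ξ))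
    _ ≤ (‖U‖ * ‖Θ ξ‖) ^ 2 := by
        gcongr
        exact Θ.norm_apply_apply_le_of_commute (hU _ hcomm) ξ
    _ = ‖U‖ ^ 2 * ‖y‖ ^ 2 := by rw [mul_pow, hξy]

theorem isBesselVector_apply (hπ : IsProjUnitaryRep mu π)
    (hξ : IsParsevalFrameOn π ξ Set.univ) {U : H →L[ℂ] H}
    (hU : U ∈ commutant (commutant (Set.range π))) : IsBesselVector π (U ξ) := by
  refine ⟨‖U‖ ^ 2 + 1, by positivity, fun x s => ?_⟩
  have h : ∑ g ∈ s, ‖⟪x, π g (U ξ)⟫_ℂ‖ ^ 2 ≤ ‖U‖ ^ 2 * ‖x‖ ^ 2 :=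
    (hξ.dense_isBesselVector hπ).induction
      (P := fun x => ∑ g ∈ s, ‖⟪x, π g (U ξ)⟫_ℂ‖ ^ 2 ≤ ‖U‖ ^ 2 * ‖x‖ ^ 2)
      (fun y hy => hξ.sum_norm_sq_le_of_isBesselVector hπ hU hy s)
      (isClosed_le (by fun_prop) (by fun_prop)) x
  nlinarith [sq_nonneg ‖x‖]

end IsParsevalFrameOn

/-- **Parameterization of Bessel vectors.** If `{π g ξ}` is a Parseval frame for `H`, then
`η` is a Bessel vector for `π` iff `η = U ξ` for some `U ∈ π(G)''`; that is,
`B_π = π(G)'' ξ`. -/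
theorem parameterization_bessel_vectors
    {G : Type*} [Group G] [Countable G]
    {H : Type*} [NormedAddCommGroup H] [InnerProductSpace ℂ H] [CompleteSpace H]
    [TopologicalSpace.SeparableSpace H]
    (mu : G → G → ℂ) (π : G → H →L[ℂ] H) (hπ : IsProjUnitaryRep mu π)
    (ξ : H) (hξ : IsParsevalFrameOn π ξ Set.univ) (η : H) :
    IsBesselVector π η ↔ ∃ U ∈ commutant (commutant (Set.range π)), η = U ξ := by
  constructor
  · exact hξ.exists_mem_bicommutant hπ
  · rintro ⟨U, hU, rfl⟩
    exact hξ.isBesselVector_apply hπ hU
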